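/- Let (C,D) be a regular inclusion and suppose (C₁,D₁,α) is a Cartan extension of (C,D): (C₁,D₁) is a Cartan inclusion with faithful conditional expectation E₁ : C₁ → D₁, and α : C → C₁ is an injective regular *-homomorphism. Let C_α be the C*-subalgebra of C₁ generated by α(C) ∪ E₁(α(C)) and let D_α be the C*-subalgebra of C₁ generated by E₁(α(C)). Then (C_α, D_α, α) is a package for (C,D); in particular (C_α, D_α) is a regular inclusion, α(N(C,D)) ⊆ N(C_α, D_α), and E₁ restricts to a faithful conditional expectation of C_α onto D_α. -/

import Mathlib

open scoped ComplexOrder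
open WeakDual
set_option linter.unusedSectionVars false

namespace RegularInclusion

variable {A : Type*} [NormedRing A] [StarRing A] [CStarRing A] [CompleteSpace A]
  [NormedAlgebra ℂ A] [StarModule ℂ A]

/-- The set of normalizers of the subalgebra `D` in `A`:
`N(A,D) = {v | v* D v ⊆ D and v D v* ⊆ D}`. -/
def normSet (D : StarSubalgebra ℂ A) : Set A :=
  {v | (∀ d ∈ D, star v * d * v ∈ D) ∧ (∀ d ∈ D, v * d * star v ∈ D)}

lemma normSet.star_mul_self_mem {D : StarSubalgebra ℂ A} {v : A} (hv : v ∈ normSet D) :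
    star v * v ∈ D := by simpa using hv.1 1 D.one_mem

lemma normSet.mul_star_self_mem {D : StarSubalgebra ℂ A} {v : A} (hv : v ∈ normSet D) :
    v * star v ∈ D := by simpa using hv.2 1 D.one_mem

/-- `D` is abelian. -/
def IsAbelian (D : StarSubalgebra ℂ A) : Prop := ∀ x ∈ D, ∀ y ∈ D, x * y = y * x

/-- `(A, D)` is an inclusion: `D` is an abelian closed unital `C*`-subalgebra of `A`. -/
def IsInclusion (D : StarSubalgebra ℂ A) : Prop := IsAbelian D ∧ IsClosed (D : Set A)

/-- `(A, D)` is a regular inclusion: an inclusion for which the closed linear span of the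
normalizers is all of `A`. -/
def IsRegularIncl (D : StarSubalgebra ℂ A) : Prop :=
  IsInclusion D ∧ closure (Submodule.span ℂ (normSet D) : Set A) = Set.univ

/-- `D` is a MASA in `A`: `D` is abelian and contains every element commuting with it. -/
def IsMasa (D : StarSubalgebra ℂ A) : Prop :=
  IsAbelian D ∧ ∀ x : A, (∀ d ∈ D, x * d = d * x) → x ∈ D

/-- The relative commutant `D^c` of `D` in `A`. -/
def relComm (D : StarSubalgebra ℂ A) : StarSubalgebra ℂ A :=
  { Subalgebra.centralizer ℂ (D : Set A) with
    star_mem' := by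
      intro x hx d hd
      have h := congrArg star (hx (star d) (star_mem hd))
      simpa [star_mul] using h.symm }

lemma mem_relComm {D : StarSubalgebra ℂ A} {x : A} :
    x ∈ relComm D ↔ ∀ d ∈ D, d * x = x * d := Iff.rfl

/-- `E : A → A` is a conditional expectation onto `D`. -/
structure IsCondExp [PartialOrder A] [StarOrderedRing A] (D : StarSubalgebra ℂ A)
    (E : A →ₗ[ℂ] A) : Prop where
  mem : ∀ x : A, E x ∈ D
  idOn : ∀ d ∈ D, E d = d
  pos : ∀ x : A, 0 ≤ x → 0 ≤ E x
  bimod : ∀ d ∈ D, ∀ d' ∈ D, ∀ x : A, E (d * x * d') = d * E x * d'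

/-- A linear map is faithful if `E (x* x) = 0` implies `x = 0`. -/
def Faithful (E : A →ₗ[ℂ] A) : Prop := ∀ x : A, E (star x * x) = 0 → x = 0

/-- `(A,D)` is a Cartan inclusion: a regular MASA inclusion admitting a faithful conditional
expectation onto `D`. -/
def IsCartanIncl [PartialOrder A] [StarOrderedRing A] (D : StarSubalgebra ℂ A) : Prop :=
  IsRegularIncl D ∧ IsMasa D ∧ ∃ E : A →ₗ[ℂ] A, IsCondExp D E ∧ Faithful E

/-- The fixed-point set of the partial homeomorphism `β_v` of the character space of `D`:
those characters `σ` with `σ(v*v) > 0` and `σ(v* h v) = σ(h)·σ(v*v)` for all `h ∈ D`. -/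
def fixBeta (D : StarSubalgebra ℂ A) {v : A} (hv : v ∈ normSet D) :
    Set (characterSpace ℂ ↥D) :=
  {σ | 0 < σ (⟨star v * v, normSet.star_mul_self_mem hv⟩ : D) ∧
    ∀ h : D, σ (⟨star v * (h : A) * v, hv.1 (h : A) h.2⟩ : D)
      = σ h * σ (⟨star v * v, normSet.star_mul_self_mem hv⟩ : D)}

/-- A subset `S` of a topological algebra `B` is essential in `B` if the only closed two-sided
ideal of `B` meeting `S` trivially is the zero ideal. -/
def EssentialInSet (B : Type*) [NonUnitalNonAssocRing B] [TopologicalSpace B]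
    (S : Set B) : Prop :=
  ∀ J : TwoSidedIdeal B, IsClosed (J : Set B) → (J : Set B) ∩ S = {0} → J = ⊥

section Two
variable {B : Type*} [NormedRing B] [StarRing B] [CStarRing B] [CompleteSpace B]
  [NormedAlgebra ℂ B] [StarModule ℂ B]

/-- A `*`-homomorphism between inclusions is regular if it maps `D` into `D₁` and
normalizers to normalizers. -/
def IsRegularHom (D : StarSubalgebra ℂ A) (D₁ : StarSubalgebra ℂ B) (α : A →⋆ₐ[ℂ] B) : Prop :=
  (∀ d ∈ D, α d ∈ D₁) ∧ (∀ v ∈ normSet D, α v ∈ normSet D₁)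

/-- `(B, D₁, α)` is a package for the regular inclusion `(A, D)`, witnessed by the faithful
conditional expectation `E₁`: `(B,D₁)` is a regular inclusion, `α` is an injective regular
`*`-homomorphism, `B` is generated as a `C*`-algebra by `α(A) ∪ E₁(α(A))` and `D₁` is
generated by `E₁(α(A))`. -/
def IsPackage [PartialOrder B] [StarOrderedRing B] (D : StarSubalgebra ℂ A)
    (D₁ : StarSubalgebra ℂ B) (α : A →⋆ₐ[ℂ] B) (E₁ : B →ₗ[ℂ] B) : Prop :=
  IsRegularIncl D₁ ∧ Function.Injective α ∧ IsRegularHom D D₁ α ∧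
    IsCondExp D₁ E₁ ∧ Faithful E₁ ∧
    (StarAlgebra.adjoin ℂ (Set.range ⇑α ∪ ⇑E₁ '' Set.range ⇑α)).topologicalClosure = ⊤ ∧
    (StarAlgebra.adjoin ℂ (⇑E₁ '' Set.range ⇑α)).topologicalClosure = D₁

/-- `(D₁, α|_D)` is an essential extension of `D`. -/
def EssentialExtIn (D : StarSubalgebra ℂ A) (D₁ : StarSubalgebra ℂ B) (α : A →⋆ₐ[ℂ] B) : Prop :=
  EssentialInSet ↥D₁ {x : ↥D₁ | ∃ d ∈ D, α d = (x : B)}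

/-- `(B, D₁, α)` is a Cartan envelope of `(A, D)`, witnessed by the faithful conditional
expectation `E₁`: a package for which `(B,D₁)` is moreover a Cartan inclusion (i.e. `D₁` is
a MASA in `B`) and `(D₁, α|_D)` is an essential extension of `D`. -/
def IsCartanEnvelope [PartialOrder B] [StarOrderedRing B] (D : StarSubalgebra ℂ A)
    (D₁ : StarSubalgebra ℂ B) (α : A →⋆ₐ[ℂ] B) (E₁ : B →ₗ[ℂ] B) : Prop :=
  IsPackage D D₁ α E₁ ∧ IsMasa D₁ ∧ EssentialExtIn D D₁ α

end Two

/-- The set of normalizers of `Dα` relative to the subalgebra `Cα`. -/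
def normSetRel (Cα Dα : StarSubalgebra ℂ A) : Set A :=
  {v | v ∈ Cα ∧ (∀ d ∈ Dα, star v * d * v ∈ Dα) ∧ (∀ d ∈ Dα, v * d * star v ∈ Dα)}

/-- `φ` is an eigenfunctional for `(A,D)` with range character `r` and source character `s`. -/
def IsEigen (D : StarSubalgebra ℂ A) (φ : A →L[ℂ] ℂ) (r s : ↥D →ₐ[ℂ] ℂ) : Prop :=
  φ ≠ 0 ∧ ∀ (d₁ d₂ : D) (x : A), φ ((d₁ : A) * x * (d₂ : A)) = r d₁ * φ x * s d₂

/-- `f` is a state on `A`. -/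
def IsState (f : A →ₗ[ℂ] ℂ) : Prop := f 1 = 1 ∧ ∀ x : A, 0 ≤ f (star x * x)

/-- `f ∈ Mod(A,D)`: a state whose restriction to `D` is multiplicative (hence a character). -/
def InMod (D : StarSubalgebra ℂ A) (f : A →ₗ[ℂ] ℂ) : Prop :=
  IsState f ∧ ∀ d₁ d₂ : D, f ((d₁ : A) * (d₂ : A)) = f (d₁ : A) * f (d₂ : A)

/-- `f` is a compatible state: a state with `|f(v)|² ∈ {0, f(v*v)}` for every normalizer `v`. -/
def IsCompatState (D : StarSubalgebra ℂ A) (f : A →ₗ[ℂ] ℂ) : Prop :=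
  IsState f ∧ ∀ v ∈ normSet D, f v = 0 ∨ (Complex.normSq (f v) : ℂ) = f (star v * v)

/-- `φ` is a compatible eigenfunctional: `|φ(v)|² ∈ {0, s(φ)(v*v)}` for every normalizer `v`. -/
def IsCompatEigen (D : StarSubalgebra ℂ A) (φ : A →L[ℂ] ℂ) (r s : ↥D →ₐ[ℂ] ℂ) : Prop :=
  IsEigen D φ r s ∧ ∀ v, ∀ hv : v ∈ normSet D,
    φ v = 0 ∨ (Complex.normSq (φ v) : ℂ)
      = s (⟨star v * v, normSet.star_mul_self_mem hv⟩ : D)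

/-- The eigenfunctional `[v,f] : x ↦ f(v* x) / f(v* v)^{1/2}`. -/
noncomputable def evf (f : A →ₗ[ℂ] ℂ) (v : A) (x : A) : ℂ :=
  f (star v * x) / (Real.sqrt (f (star v * v)).re : ℂ)

/-- A bundled unital `C*`-algebra (with its canonical partial order). -/
structure CSA where
  carrier : Type
  [nr : NormedRing carrier]
  [sr : StarRing carrier]
  [cs : CStarRing carrier]
  [cp : CompleteSpace carrier]
  [na : NormedAlgebra ℂ carrier]
  [sm : StarModule ℂ carrier]
  [po : PartialOrder carrier]
  [sor : StarOrderedRing carrier]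

attribute [instance] CSA.nr CSA.sr CSA.cs CSA.cp CSA.na CSA.sm CSA.po CSA.sor

end RegularInclusion

namespace RegularInclusion

variable {A : Type*} [NormedRing A] [StarRing A] [CStarRing A] [CompleteSpace A]
  [NormedAlgebra ℂ A] [StarModule ℂ A]

variable {B : Type*} [NormedRing B] [StarRing B] [CStarRing B] [CompleteSpace B]
  [NormedAlgebra ℂ B] [StarModule ℂ B] [PartialOrder B] [StarOrderedRing B]

theorem _root_.CStarAlgebra.exists_tendsto_mul_star_mul_self {M : Type*} [CStarAlgebra M]
    {S : StarSubalgebra ℂ M} (hS : IsClosed (S : Set M)) {v : M} (hv : star v * v ∈ S) :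
    ∃ c : ℕ → M, (∀ n, c n ∈ S) ∧
      Filter.Tendsto (fun n => v * (star v * v) * c n) Filter.atTop (nhds v) := by
  let : PartialOrder M := CStarAlgebra.spectralOrder M
  let : StarOrderedRing M := CStarAlgebra.spectralOrderedRing M
  set b := star v * v with hb
  have hbs : IsSelfAdjoint b := .star_mul_self v
  let g : ℕ → ℝ → ℝ := fun n t => (|t| + 1 / ((n : ℝ) + 1))⁻¹
  have hε : ∀ n : ℕ, (0 : ℝ) < 1 / ((n : ℝ) + 1) := fun n => by positivity
  have hg : ∀ n, Continuous (g n) := fun n =>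
    Continuous.inv₀ (by fun_prop) fun t => by have := hε n; positivity
  refine ⟨fun n => cfc (g n) b, fun n => ?_, ?_⟩
  · have := hS
    exact cfc_mem (𝕜' := ℂ) _ hv
  rw [tendsto_iff_norm_sub_tendsto_zero]
  have hbound : ∀ n : ℕ, ‖v * b * cfc (g n) b - v‖ ^ 2 ≤ 1 / ((n : ℝ) + 1) := by
    intro n
    let k : ℝ → ℝ := fun t => t * g n t - 1
    have hk : Continuous k := by have := hg n; fun_prop
    have hkb : b * cfc (g n) b - 1 = cfc k b := by
      have := hg n
      rw [cfc_sub (R := ℝ) (fun t => t * g n t) (fun _ => 1) b (by fun_prop) (by fun_prop),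
        cfc_mul (R := ℝ) (fun t => t) (g n) b (by fun_prop) (by fun_prop), cfc_id' ℝ b,
        cfc_const_one ℝ b]
    have hks : star (cfc k b) = cfc k b := (cfc_predicate (p := IsSelfAdjoint) k b)
    have hvk : v * b * cfc (g n) b - v = v * cfc k b := by rw [← hkb]; noncomm_ring
    have hkk : cfc k b * star v * (v * cfc k b) = cfc (fun t => k t * t * k t) b := by
      rw [cfc_mul (R := ℝ) (fun t => k t * t) k b (by fun_prop) (by fun_prop),
        cfc_mul (R := ℝ) k (fun t => t) b (by fun_prop) (by fun_prop), cfc_id' ℝ b, hb]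
      noncomm_ring
    rw [hvk, sq, ← CStarRing.norm_star_mul_self, star_mul, hks, hkk]
    refine norm_cfc_le (hε n).le fun t ht => ?_
    have ht0 : 0 ≤ t := spectrum_nonneg_of_nonneg (star_mul_self_nonneg v) ht
    have hε := hε n
    simp only [k, g, abs_of_nonneg ht0]
    generalize 1 / ((n : ℝ) + 1) = ε at *
    have h1 : t * (t + ε)⁻¹ - 1 = -(ε / (t + ε)) := by field_simp; ring
    have h2 : -(ε / (t + ε)) * t * -(ε / (t + ε)) = ε * (ε * t) / (t + ε) ^ 2 := by field_simp
    rw [h1, h2, Real.norm_of_nonneg (by positivity), div_le_iff₀ (by positivity)]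
    nlinarith [mul_nonneg hε.le ht0, mul_nonneg (mul_nonneg hε.le ht0) ht0, pow_pos hε 3,
      mul_nonneg (mul_nonneg hε.le hε.le) ht0]
  have h2 : Filter.Tendsto (fun n : ℕ => ‖v * b * cfc (g n) b - v‖ ^ 2) Filter.atTop (nhds 0) :=
    squeeze_zero (fun n => by positivity) hbound tendsto_one_div_add_atTop_nhds_zero_nat
  simpa using h2.sqrt

theorem _root_.CStarAlgebra.continuous_of_map_nonneg {M : Type*} [CStarAlgebra M] [PartialOrder M]
    [StarOrderedRing M] (E : M →ₗ[ℂ] M) (h : ∀ x, 0 ≤ x → 0 ≤ E x) : Continuous E :=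
  map_continuous (PositiveLinearMap.mk₀ E h)

theorem _root_.CStarAlgebra.continuous_starAlgHom {M N : Type*} [CStarAlgebra M] [CStarAlgebra N]
    (α : M →⋆ₐ[ℂ] N) : Continuous α :=
  AddMonoidHomClass.continuous_of_bound α 1 fun a => by
    simpa using NonUnitalStarAlgHom.norm_apply_le α a

theorem continuous_starAlgHom {M N : Type*} [NormedRing M] [StarRing M] [CStarRing M]
    [CompleteSpace M] [NormedAlgebra ℂ M] [StarModule ℂ M] [NormedRing N] [StarRing N]
    [CStarRing N] [CompleteSpace N] [NormedAlgebra ℂ N] [StarModule ℂ N]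
    (α : M →⋆ₐ[ℂ] N) : Continuous α :=
  @CStarAlgebra.continuous_starAlgHom M N { } { } α

theorem IsCondExp.continuous {D : StarSubalgebra ℂ B} {E : B →ₗ[ℂ] B} (hE : IsCondExp D E) :
    Continuous E :=
  @CStarAlgebra.continuous_of_map_nonneg B { } _ _ E hE.pos

theorem exists_tendsto_mul_star_mul_self {S : StarSubalgebra ℂ A} (hS : IsClosed (S : Set A))
    {v : A} (hv : star v * v ∈ S) :
    ∃ c : ℕ → A, (∀ n, c n ∈ S) ∧
      Filter.Tendsto (fun n => v * (star v * v) * c n) Filter.atTop (nhds v) :=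
  @CStarAlgebra.exists_tendsto_mul_star_mul_self A { } S hS v hv

theorem map_mem_of_mem_closure_span {M N : Type*} [AddCommGroup M] [Module ℂ M]
    [TopologicalSpace M] [AddCommGroup N] [Module ℂ N] [TopologicalSpace N] (φ : M →ₗ[ℂ] N)
    (hφ : Continuous φ) {G : Set M} {P : Submodule ℂ N} (hP : IsClosed (P : Set N))
    (h : ∀ g ∈ G, φ g ∈ P) {m : M} (hm : m ∈ closure (Submodule.span ℂ G : Set M)) :
    φ m ∈ P := by
  have hle : Submodule.span ℂ G ≤ P.comap φ := Submodule.span_le.2 h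
  exact closure_minimal hle (hP.preimage hφ) hm

theorem star_mem_normSet {D : StarSubalgebra ℂ A} {v : A} (hv : v ∈ normSet D) :
    star v ∈ normSet D :=
  ⟨fun d hd => by simpa using hv.2 d hd, fun d hd => by simpa using hv.1 d hd⟩

theorem mul_mem_normSet {D : StarSubalgebra ℂ A} {v w : A} (hv : v ∈ normSet D)
    (hw : w ∈ normSet D) : v * w ∈ normSet D :=
  ⟨fun d hd => by simpa [mul_assoc] using hw.1 _ (hv.1 d hd),
    fun d hd => by simpa [mul_assoc] using hv.2 _ (hw.2 d hd)⟩

theorem one_mem_normSet (D : StarSubalgebra ℂ A) : (1 : A) ∈ normSet D :=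
  ⟨fun d hd => by simpa using hd, fun d hd => by simpa using hd⟩

theorem IsCondExp.map_mul_left {D : StarSubalgebra ℂ B} {E : B →ₗ[ℂ] B} (hE : IsCondExp D E)
    {d : B} (hd : d ∈ D) (x : B) : E (d * x) = d * E x := by
  simpa using hE.bimod d hd 1 D.one_mem x

theorem IsCondExp.map_mul_right {D : StarSubalgebra ℂ B} {E : B →ₗ[ℂ] B} (hE : IsCondExp D E)
    {d : B} (hd : d ∈ D) (x : B) : E (x * d) = E x * d := by
  simpa using hE.bimod 1 D.one_mem d hd x

/-- For a MASA `D` with conditional expectation `E` and a normalizer `w`, the element `E(w)* w`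
commutes with `D`, hence lies in `D`, and so equals `E(w)* E(w)`. -/
theorem IsCondExp.star_map_mul_self {D : StarSubalgebra ℂ B} (hcl : IsClosed (D : Set B))
    (hm : IsMasa D) {E : B →ₗ[ℂ] B} (hE : IsCondExp D E) {w : B} (hw : w ∈ normSet D) :
    star (E w) * w = star (E w) * E w := by
  set h := E w
  have hh : h ∈ D := hE.mem w
  set b := star w * w with hb
  have hbD : b ∈ D := normSet.star_mul_self_mem hw
  obtain ⟨c, hc, hlim⟩ := exists_tendsto_mul_star_mul_self hcl hbD
  have hmap : ∀ d ∈ D, h * d * b = w * d * star w * h := fun d hd => by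
    have h1 : w * (d * b) = w * d * star w * w := by rw [hb]; noncomm_ring
    have h2 := congrArg E h1
    rw [hE.map_mul_right (mul_mem hd hbD), hE.map_mul_left (hw.2 d hd)] at h2
    rw [← h2, mul_assoc]
  have hkey : ∀ d ∈ D, star h * w * d * b = b * d * (star h * w) := fun d hd => by
    have h1 := congrArg star (hmap (star d) (star_mem hd))
    simp only [star_mul, star_star, hb] at h1
    calc star h * w * d * b = star h * (w * (d * star w)) * w := by rw [hb]; noncomm_ring
      _ = b * d * (star h * w) := by rw [← h1, hb]; noncomm_ring
  have hqb : star h * w * b = b * (star h * w) := by simpa using hkey 1 D.one_mem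
  have hcomm : ∀ d ∈ D, star h * w * d = d * (star h * w) := fun d hd => by
    have l1 := (hlim.const_mul (star h)).mul_const d
    have l2 := hlim.const_mul (d * star h)
    rw [mul_assoc d] at l2
    refine tendsto_nhds_unique (l1.congr fun n => ?_) l2
    calc star h * (w * b * c n) * d = star h * w * (b * (c n * d)) := by noncomm_ring
      _ = star h * w * d * b * c n := by
        rw [hm.1 _ (hc n) d hd, ← mul_assoc b, hm.1 _ hbD d hd]; noncomm_ring
      _ = d * (star h * w * b) * c n := by
        rw [hkey d hd, hm.1 _ hbD d hd, hqb]; noncomm_ring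
      _ = d * star h * (w * b * c n) := by noncomm_ring
  rw [← hE.idOn _ (hm.2 _ hcomm), hE.map_mul_left (star_mem hh)]

theorem IsCondExp.map_conj_of_normalizer {D : StarSubalgebra ℂ B} (hcl : IsClosed (D : Set B))
    (hm : IsMasa D) {E : B →ₗ[ℂ] B} (hE : IsCondExp D E) {v w : B} (hv : v ∈ normSet D)
    (hw : w ∈ normSet D) : E (star v * w * v) = star v * E w * v := by
  have hq := hE.star_map_mul_self hcl hm hw
  have hu := hE.star_map_mul_self hcl hm
    (mul_mem_normSet (mul_mem_normSet (star_mem_normSet hv) hw) hv)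
  set h := E w
  have hh : h ∈ D := hE.mem w
  set e := E (star v * w * v) with he_def
  have he : e ∈ D := hE.mem _
  set f := star v * h * v with hf_def
  have hf : f ∈ D := hv.1 h hh
  set b := star v * v with hb
  have hbD : b ∈ D := normSet.star_mul_self_mem hv
  obtain ⟨c, hc, hlim⟩ := exists_tendsto_mul_star_mul_self hcl hbD
  rw [← hb] at hlim
  have hvv : v * star v * star h = star h * (v * star v) :=
    hm.1 _ (normSet.mul_star_self_mem hv) _ (star_mem hh)
  have hfe : star f * e = star f * f := by
    rw [he_def, ← hE.map_mul_left (star_mem hf), ← hE.idOn _ (mul_mem (star_mem hf) hf)]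
    congr 1
    calc star f * (star v * w * v) = star v * (star h * (v * star v)) * w * v := by
          simp only [hf_def, star_mul, star_star]; noncomm_ring
      _ = star v * (v * star v) * (star h * w) * v := by rw [← hvv]; noncomm_ring
      _ = star v * (v * star v * star h) * h * v := by rw [hq]; noncomm_ring
      _ = star f * f := by
        rw [hvv]; simp only [hf_def, star_mul, star_star]; noncomm_ring
  have hef : star e * f = star f * f := by simpa using congrArg star hfe
  have hconj : v * (star e * f) * star v = v * (star e * e) * star v := by
    have h1 : v * star e * star v * (w * (v * star v)) = v * (star e * e) * star v := by
      rw [← hu]; noncomm_ring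
    have h2 := congrArg E h1
    rw [hE.map_mul_left (hv.2 _ (star_mem he)),
      hE.map_mul_right (normSet.mul_star_self_mem hv),
      hE.idOn _ (hv.2 _ (mul_mem (star_mem he) he))] at h2
    rw [← h2, hf_def]; noncomm_ring
  set X := star f * f - star e * e with hX
  have hXD : X ∈ D := sub_mem (mul_mem (star_mem hf) hf) (mul_mem (star_mem he) he)
  have hXlim : Filter.Tendsto (fun n => X * b * c n) Filter.atTop (nhds X) := by
    have l1 := hlim.const_mul (star f * (star v * h))
    have l2 := ((hE.continuous.tendsto _).comp (hlim.const_mul (star v * w))).const_mul (star e)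
    have h1 : star f * (star v * h) * v = star f * f := by rw [hf_def]; noncomm_ring
    rw [h1] at l1
    refine (l1.sub l2).congr fun n => ?_
    have h2 : E (star v * w * (v * b * c n)) = e * (b * c n) := by
      rw [he_def, ← hE.map_mul_right (mul_mem hbD (hc n))]; congr 1; noncomm_ring
    simp only [Function.comp_apply, h2, hX]
    rw [hf_def]; noncomm_ring
  have hXbb : X * b * b = 0 := by
    rw [hm.1 X hXD b hbD]
    calc b * X * b = star v * (v * (star f * f) * star v) * v
          - star v * (v * (star e * e) * star v) * v := by rw [hX, hb]; noncomm_ring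
      _ = 0 := by rw [← hef, hconj, sub_self]
  have hXb : X * b = 0 := by
    refine tendsto_nhds_unique (hXlim.mul_const b) (tendsto_const_nhds.congr fun n => ?_)
    rw [mul_assoc _ (c n), hm.1 _ (hc n) b hbD, ← mul_assoc, hXbb, zero_mul]
  have hX0 : X = 0 := by
    refine tendsto_nhds_unique hXlim (tendsto_const_nhds.congr fun n => ?_)
    rw [hXb, zero_mul]
  rw [← sub_eq_zero, ← CStarRing.star_mul_self_eq_zero_iff]
  calc star (e - f) * (e - f)
      = star e * e - star e * f - star f * e + star f * f := by rw [star_sub]; noncomm_ring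
    _ = 0 := by rw [hef, hfe, ← sub_eq_zero.1 hX0]; noncomm_ring

/-- The conditional expectation onto a Cartan MASA commutes with conjugation by normalizers. -/
theorem IsCondExp.map_conj {D : StarSubalgebra ℂ B} (hreg : IsRegularIncl D) (hm : IsMasa D)
    {E : B →ₗ[ℂ] B} (hE : IsCondExp D E) {v : B} (hv : v ∈ normSet D) (x : B) :
    E (star v * x * v) = star v * E x * v := by
  let φ : B →ₗ[ℂ] B := LinearMap.mulRight ℂ v ∘ₗ LinearMap.mulLeft ℂ (star v)
  have hφ : Continuous φ := by
    change Continuous fun x => star v * x * v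
    fun_prop
  have hE' := hE.continuous
  have hψ : Continuous (E ∘ₗ φ - φ ∘ₗ E) := (hE'.comp hφ).sub (hφ.comp hE')
  have h := map_mem_of_mem_closure_span (E ∘ₗ φ - φ ∘ₗ E) hψ (G := normSet D) (P := ⊥)
    (m := x) isClosed_singleton
    (fun w hw => by simpa [φ, sub_eq_zero] using hE.map_conj_of_normalizer hreg.1.2 hm hv hw)
    (by rw [hreg.2]; trivial)
  simpa [φ, sub_eq_zero] using h

theorem conj_mem_topologicalClosure_adjoin {D : StarSubalgebra ℂ A} (hD : IsAbelian D) {S : Set A}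
    (hS : (StarAlgebra.adjoin ℂ S).topologicalClosure ≤ D) {v : A} (hv : v ∈ normSet D)
    (hvv : star v * v ∈ (StarAlgebra.adjoin ℂ S).topologicalClosure)
    (hmem : ∀ s ∈ S, star v * s * v ∈ (StarAlgebra.adjoin ℂ S).topologicalClosure) {d : A}
    (hd : d ∈ (StarAlgebra.adjoin ℂ S).topologicalClosure) :
    star v * d * v ∈ (StarAlgebra.adjoin ℂ S).topologicalClosure := by
  set T := (StarAlgebra.adjoin ℂ S).topologicalClosure with hT
  have hTcl : IsClosed (T : Set A) := StarSubalgebra.isClosed_topologicalClosure _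
  have hle : StarAlgebra.adjoin ℂ S ≤ T := StarSubalgebra.le_topologicalClosure _
  obtain ⟨c, hc, hlim⟩ := exists_tendsto_mul_star_mul_self hTcl hvv
  have hadj : ∀ x ∈ StarAlgebra.adjoin ℂ S, star v * x * v ∈ T := by
    intro x hx
    induction hx using StarAlgebra.adjoin_induction with
    | mem x h => exact hmem x h
    | algebraMap r =>
      rw [Algebra.algebraMap_eq_smul_one, mul_smul_comm, mul_one, smul_mul_assoc]
      exact T.smul_mem hvv r
    | add x y _ _ hx hy => rw [mul_add, add_mul]; exact add_mem hx hy
    | mul x y hx' hy' hx hy =>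
      refine hTcl.mem_of_tendsto (hlim.const_mul (star v * (x * y)))
        (Filter.Eventually.of_forall fun n => ?_)
      have hcomm : y * (v * star v) = v * star v * y :=
        hD _ (hS (hle hy')) _ (normSet.mul_star_self_mem hv)
      have h1 : star v * (x * y) * (v * (star v * v) * c n)
          = star v * x * v * (star v * y * v) * c n := by
        calc star v * (x * y) * (v * (star v * v) * c n)
            = star v * x * (y * (v * star v)) * v * c n := by noncomm_ring
          _ = star v * x * v * (star v * y * v) * c n := by rw [hcomm]; noncomm_ring
      rw [h1]
      exact mul_mem (mul_mem hx hy) (hc n)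
    | star x _ hx => simpa [mul_assoc] using star_mem hx
  have hcont : Continuous fun x => star v * x * v := by fun_prop
  exact closure_minimal (t := (fun x => star v * x * v) ⁻¹' T) hadj (hTcl.preimage hcont) hd

/-- from a Cartan extension `(B, D₁, α)` of a regular inclusion `(A,D)` one
obtains a package: with `Cα = C*(α(A) ∪ E₁(α(A)))` and `Dα = C*(E₁(α(A)))`, the pair
`(Cα, Dα)` is a regular inclusion, `α(N(A,D)) ⊆ N(Cα,Dα)`, and `E₁` restricts to a faithful
conditional expectation of `Cα` onto `Dα`. -/
theorem stmt13 (D : StarSubalgebra ℂ A) (hreg : IsRegularIncl D)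
    (D₁ : StarSubalgebra ℂ B) (hc1 : IsRegularIncl D₁) (hm1 : IsMasa D₁)
    (E₁ : B →ₗ[ℂ] B) (hE₁ : IsCondExp D₁ E₁) (hf₁ : Faithful E₁)
    (α : A →⋆ₐ[ℂ] B) (hα : Function.Injective α) (hαreg : IsRegularHom D D₁ α) :
    (StarAlgebra.adjoin ℂ (⇑E₁ '' Set.range ⇑α)).topologicalClosure
        ≤ (StarAlgebra.adjoin ℂ (Set.range ⇑α ∪ ⇑E₁ '' Set.range ⇑α)).topologicalClosure ∧
    IsAbelian ((StarAlgebra.adjoin ℂ (⇑E₁ '' Set.range ⇑α)).topologicalClosure) ∧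
    (((StarAlgebra.adjoin ℂ (Set.range ⇑α ∪ ⇑E₁ '' Set.range ⇑α)).topologicalClosure :
          StarSubalgebra ℂ B) : Set B)
      ⊆ closure (Submodule.span ℂ
          (normSetRel
            ((StarAlgebra.adjoin ℂ (Set.range ⇑α ∪ ⇑E₁ '' Set.range ⇑α)).topologicalClosure)
            ((StarAlgebra.adjoin ℂ (⇑E₁ '' Set.range ⇑α)).topologicalClosure)) : Set B) ∧
    (∀ x : A, α x ∈
        (StarAlgebra.adjoin ℂ (Set.range ⇑α ∪ ⇑E₁ '' Set.range ⇑α)).topologicalClosure) ∧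
    (∀ v ∈ normSet D, α v ∈
        normSetRel
          ((StarAlgebra.adjoin ℂ (Set.range ⇑α ∪ ⇑E₁ '' Set.range ⇑α)).topologicalClosure)
          ((StarAlgebra.adjoin ℂ (⇑E₁ '' Set.range ⇑α)).topologicalClosure)) ∧
    (∀ x ∈ (StarAlgebra.adjoin ℂ (Set.range ⇑α ∪ ⇑E₁ '' Set.range ⇑α)).topologicalClosure,
        E₁ x ∈ (StarAlgebra.adjoin ℂ (⇑E₁ '' Set.range ⇑α)).topologicalClosure) ∧
    (∀ d ∈ (StarAlgebra.adjoin ℂ (⇑E₁ '' Set.range ⇑α)).topologicalClosure, E₁ d = d) ∧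
    (∀ x ∈ (StarAlgebra.adjoin ℂ (Set.range ⇑α ∪ ⇑E₁ '' Set.range ⇑α)).topologicalClosure,
        E₁ (star x * x) = 0 → x = 0) := by
  set S : Set B := ⇑E₁ '' Set.range ⇑α with hS
  set T := (StarAlgebra.adjoin ℂ S).topologicalClosure with hT
  set C := (StarAlgebra.adjoin ℂ (Set.range ⇑α ∪ S)).topologicalClosure with hC
  have hTcl : IsClosed (T : Set B) := StarSubalgebra.isClosed_topologicalClosure _
  have hCcl : IsClosed (C : Set B) := StarSubalgebra.isClosed_topologicalClosure _
  have hTC : T ≤ C := StarSubalgebra.topologicalClosure_mono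
    (StarAlgebra.adjoin_mono Set.subset_union_right)
  have hTD : T ≤ D₁ := StarSubalgebra.topologicalClosure_minimal
    (StarAlgebra.adjoin_le (by rintro _ ⟨x, -, rfl⟩; exact hE₁.mem x)) hc1.1.2
  have hαC : ∀ x, α x ∈ C := fun x => StarSubalgebra.le_topologicalClosure _
    (StarAlgebra.subset_adjoin ℂ _ (Or.inl ⟨x, rfl⟩))
  have hEαT : ∀ x, E₁ (α x) ∈ T := fun x => StarSubalgebra.le_topologicalClosure _
    (StarAlgebra.subset_adjoin ℂ _ ⟨_, ⟨x, rfl⟩, rfl⟩)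
  have hDT : ∀ d ∈ D, α d ∈ T := fun d hd => by
    rw [← hE₁.idOn _ (hαreg.1 d hd)]; exact hEαT d
  have hid : ∀ d ∈ T, E₁ d = d := fun d hd => hE₁.idOn d (hTD hd)
  have habT : IsAbelian T := fun x hx y hy => hm1.1 x (hTD hx) y (hTD hy)
  have hconj : ∀ v ∈ normSet D, ∀ d ∈ T, star (α v) * d * α v ∈ T := fun v hv d hd => by
    refine conj_mem_topologicalClosure_adjoin hm1.1 hTD (hαreg.2 v hv) ?_ ?_ hd
    · rw [← map_star, ← map_mul]; exact hDT _ (normSet.star_mul_self_mem hv)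
    · rintro _ ⟨_, ⟨x, rfl⟩, rfl⟩
      rw [← hE₁.map_conj hc1 hm1 (hαreg.2 v hv), ← map_star, ← map_mul, ← map_mul]
      exact hEαT _
  have hconj' : ∀ v ∈ normSet D, ∀ d ∈ T, α v * d * star (α v) ∈ T := fun v hv d hd => by
    have h := hconj (star v) (star_mem_normSet hv) d hd
    rwa [map_star, star_star] at h
  let G : Set B := {x | ∃ v ∈ normSet D, ∃ d ∈ T, α v * d = x}
  have hGN : G ⊆ normSetRel C T := by
    rintro _ ⟨v, hv, d, hd, rfl⟩
    refine ⟨mul_mem (hαC v) (hTC hd), fun x hx => ?_, fun x hx => ?_⟩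
    · simpa [mul_assoc] using mul_mem (mul_mem (star_mem hd) (hconj v hv x hx)) hd
    · simpa [mul_assoc] using hconj' v hv _ (mul_mem (mul_mem hd hx) (star_mem hd))
  let P : Submodule ℂ B := (Submodule.span ℂ G).topologicalClosure
  have hP : IsClosed (P : Set B) := Submodule.isClosed_topologicalClosure _
  have hGP : G ⊆ P := Submodule.subset_span.trans (Submodule.le_topologicalClosure _)
  have hαP : ∀ v ∈ normSet D, α v ∈ P := fun v hv => hGP ⟨v, hv, 1, T.one_mem, mul_one _⟩
  have h1P : (1 : B) ∈ P := by simpa using hαP 1 (one_mem_normSet D)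
  have hαmul : ∀ a, ∀ m ∈ P, α a * m ∈ P := fun a m hm => by
    refine map_mem_of_mem_closure_span (LinearMap.mulRight ℂ m ∘ₗ α.toAlgHom.toLinearMap)
      ((continuous_starAlgHom α).mul continuous_const) (G := normSet D) hP (fun v hv => ?_)
      (by rw [hreg.2]; trivial)
    refine map_mem_of_mem_closure_span (LinearMap.mulLeft ℂ (α v))
      (continuous_const.mul continuous_id) (G := G) hP ?_ hm
    rintro _ ⟨w, hw, d, hd, rfl⟩
    exact hGP ⟨v * w, mul_mem_normSet hv hw, d, hd, by simp [mul_assoc]⟩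
  have hTmul : ∀ d ∈ T, ∀ m ∈ P, d * m ∈ P := fun d hd m hm => by
    refine map_mem_of_mem_closure_span (LinearMap.mulLeft ℂ d)
      (continuous_const.mul continuous_id) (G := G) hP ?_ hm
    rintro _ ⟨v, hv, d', hd', rfl⟩
    have hb : star (α v) * α v ∈ T := by
      rw [← map_star, ← map_mul]; exact hDT _ (normSet.star_mul_self_mem hv)
    obtain ⟨c, hc, hlim⟩ := exists_tendsto_mul_star_mul_self hTcl hb
    have hl := (hlim.const_mul d).mul_const d'
    rw [mul_assoc] at hl
    refine hP.mem_of_tendsto hl (Filter.Eventually.of_forall fun n => hGP ?_)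
    refine ⟨v, hv, star (α v) * d * α v * c n * d',
      mul_mem (mul_mem (hconj v hv d hd) (hc n)) hd', ?_⟩
    have hcomm := hm1.1 _ (normSet.mul_star_self_mem (hαreg.2 v hv)) d (hTD hd)
    calc α v * (star (α v) * d * α v * c n * d')
        = α v * star (α v) * d * (α v * c n * d') := by noncomm_ring
      _ = d * (α v * (star (α v) * α v) * c n) * d' := by rw [hcomm]; noncomm_ring
  have hmul : ∀ x ∈ StarAlgebra.adjoin ℂ (Set.range ⇑α ∪ S),
      (∀ m ∈ P, x * m ∈ P) ∧ ∀ m ∈ P, star x * m ∈ P := by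
    intro x hx
    induction hx using StarAlgebra.adjoin_induction with
    | mem x h =>
      obtain ⟨a, rfl⟩ | ⟨_, ⟨a, rfl⟩, rfl⟩ := h
      · exact ⟨hαmul a, by rw [← map_star]; exact hαmul _⟩
      · exact ⟨hTmul _ (hEαT a), hTmul _ (star_mem (hEαT a))⟩
    | algebraMap r =>
      exact ⟨hTmul _ (T.algebraMap_mem r), hTmul _ (star_mem (T.algebraMap_mem r))⟩
    | add x y _ _ hx hy =>
      exact ⟨fun m hm => by rw [add_mul]; exact add_mem (hx.1 m hm) (hy.1 m hm),
        fun m hm => by rw [star_add, add_mul]; exact add_mem (hx.2 m hm) (hy.2 m hm)⟩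
    | mul x y _ _ hx hy =>
      exact ⟨fun m hm => by rw [mul_assoc]; exact hx.1 _ (hy.1 m hm),
        fun m hm => by rw [star_mul, mul_assoc]; exact hy.2 _ (hx.2 m hm)⟩
    | star x _ hx => exact ⟨hx.2, by simpa using hx.1⟩
  have hCP : ∀ x ∈ C, x ∈ P := fun x hx =>
    closure_minimal (fun y hy => by simpa using (hmul y hy).1 1 h1P) hP hx
  refine ⟨hTC, habT, fun x hx => closure_mono (Submodule.span_mono hGN) (hCP x hx), hαC,
    fun v hv => ⟨hαC v, hconj v hv, hconj' v hv⟩, fun x hx => ?_, hid, fun x _ => hf₁ x⟩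
  refine map_mem_of_mem_closure_span E₁ hE₁.continuous (G := G)
    (P := T.toSubalgebra.toSubmodule) hTcl ?_ (hCP x hx)
  rintro _ ⟨v, hv, d, hd, rfl⟩
  rw [hE₁.map_mul_right (hTD hd)]
  exact T.mul_mem (hEαT v) hd

end RegularInclusion
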